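/- Let L_W = [[L₁, 0], [−C, L₂ + D_C]] be the block Laplacian of a weakly connected digraph with two strongly connected components joined by the cutset C (C ∈ ℝ^{m×n} nonnegative with at least one positive entry, D_C the diagonal of the row sums of C). Suppose the spectral gap of L_W equals the minimal eigenvalue μ of L₂ + D_C, i.e. every nonzero eigenvalue of L₁ has real part strictly greater than μ. Then for every nonnegative matrix Δ ∈ ℝ^{m×n} with Δ ≠ 0, the spectral gap of the perturbed Laplacian L_p(Δ) = [[L₁, 0], [−C − Δ, L₂ + D_C + D_Δ]] (D_Δ the diagonal of the row sums of Δ) is strictly greater than μ: reinforcing the cutset strictly increases the network's synchronizability. -/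

import Mathlib

open Matrix Finset

/-- The graph Laplacian `L = D_W - W` of a weighted digraph with weight matrix `W`. -/
noncomputable def lapl {m : ℕ} (W : Matrix (Fin m) (Fin m) ℝ) : Matrix (Fin m) (Fin m) ℝ :=
  Matrix.diagonal (fun i => ∑ j, W i j) - W

/-- A nonnegative matrix is irreducible (its digraph is strongly connected). -/
def Irreducible' {m : ℕ} (A : Matrix (Fin m) (Fin m) ℝ) : Prop :=
  ∀ i j : Fin m, i ≠ j → ∃ k : ℕ, 0 < (A ^ k) i j

/-- The spectral gap of a Laplacian matrix: the minimum of `Re λ` over its nonzero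
(complex) eigenvalues `λ`. -/
noncomputable def spectralGap {ι : Type*} [Fintype ι] [DecidableEq ι]
    (L : Matrix ι ι ℝ) : ℝ :=
  sInf {r : ℝ | ∃ z ∈ spectrum ℂ (L.map Complex.ofReal), z ≠ 0 ∧ z.re = r}

theorem pow_entries_nonneg {m : ℕ} {A : Matrix (Fin m) (Fin m) ℝ} (hA : ∀ i j, 0 ≤ A i j)
    (k : ℕ) (i j : Fin m) : 0 ≤ (A ^ k) i j := by
  induction k generalizing i j with
  | zero => rw [pow_zero, Matrix.one_apply]; split_ifs <;> norm_num
  | succ k ih =>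
    rw [pow_succ, Matrix.mul_apply]
    exact Finset.sum_nonneg fun l _ => mul_nonneg (ih i l) (hA l j)

theorem pow_entries_mono {m : ℕ} {A B : Matrix (Fin m) (Fin m) ℝ} (hA : ∀ i j, 0 ≤ A i j)
    (hAB : ∀ i j, A i j ≤ B i j) (k : ℕ) (i j : Fin m) : (A ^ k) i j ≤ (B ^ k) i j := by
  induction k generalizing i j with
  | zero => simp
  | succ k ih =>
    rw [pow_succ, pow_succ, Matrix.mul_apply, Matrix.mul_apply]
    exact Finset.sum_le_sum fun l _ => mul_le_mul (ih i l) (hAB l j) (hA l j)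
      ((pow_entries_nonneg hA k i l).trans (ih i l))

theorem Irreducible'.mono {m : ℕ} {A B : Matrix (Fin m) (Fin m) ℝ} (h : Irreducible' A)
    (hA : ∀ i j, 0 ≤ A i j) (hAB : ∀ i j, A i j ≤ B i j) : Irreducible' B := by
  intro i j hij
  obtain ⟨k, hk⟩ := h i j hij
  exact ⟨k, hk.trans_le (pow_entries_mono hA hAB k i j)⟩

/-- A nonnegative irreducible matrix commutes with an entrywise positive matrix. -/
theorem Irreducible'.exists_commute_pos {m : ℕ} {A : Matrix (Fin m) (Fin m) ℝ}
    (h : Irreducible' A) (hA : ∀ i j, 0 ≤ A i j) :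
    ∃ P : Matrix (Fin m) (Fin m) ℝ, Commute P A ∧ ∀ i j, 0 < P i j := by
  have h' : ∀ p : Fin m × Fin m, ∃ k : ℕ, 0 < (A ^ k) p.1 p.2 := by
    rintro ⟨i, j⟩
    by_cases hij : i = j
    · exact ⟨0, by simp [hij]⟩
    · exact h i j hij
  choose f hf using h'
  refine ⟨∑ k ∈ Finset.univ.image f, A ^ k,
    Commute.sum_left _ _ _ fun k _ => (Commute.refl A).pow_left k, fun i j => ?_⟩
  rw [Matrix.sum_apply]
  exact Finset.sum_pos' (fun k _ => pow_entries_nonneg hA k i j)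
    ⟨f (i, j), Finset.mem_image_of_mem _ (Finset.mem_univ _), hf (i, j)⟩

theorem mulVec_nonneg_of_nonneg {m : ℕ} {A : Matrix (Fin m) (Fin m) ℝ} (hA : ∀ i j, 0 ≤ A i j)
    {x : Fin m → ℝ} (hx : ∀ i, 0 ≤ x i) (i : Fin m) : 0 ≤ (A *ᵥ x) i := by
  simp only [Matrix.mulVec, dotProduct]
  exact Finset.sum_nonneg fun j _ => mul_nonneg (hA i j) (hx j)

theorem mulVec_pos_of_pos {m : ℕ} {P : Matrix (Fin m) (Fin m) ℝ} (hP : ∀ i j, 0 < P i j)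
    {x : Fin m → ℝ} (hx : ∀ i, 0 ≤ x i) (hx0 : x ≠ 0) (i : Fin m) : 0 < (P *ᵥ x) i := by
  obtain ⟨j, hj⟩ := Function.ne_iff.mp hx0
  exact Finset.sum_pos' (fun l _ => mul_nonneg (hP i l).le (hx l))
    ⟨j, Finset.mem_univ _, mul_pos (hP i j) ((hx j).lt_of_ne' hj)⟩

/-- The maximum in the Collatz–Wielandt formula is attained. -/
theorem exists_collatzWielandt_max {m : ℕ} [NeZero m] {A : Matrix (Fin m) (Fin m) ℝ}
    (hA : ∀ i j, 0 ≤ A i j) :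
    ∃ r : ℝ, 0 ≤ r ∧ ∃ x ∈ stdSimplex ℝ (Fin m), (∀ i, r * x i ≤ (A *ᵥ x) i) ∧
      ∀ r' : ℝ, 0 ≤ r' → ∀ y ∈ stdSimplex ℝ (Fin m), (∀ i, r' * y i ≤ (A *ᵥ y) i) → r' ≤ r := by
  set K : Set (ℝ × (Fin m → ℝ)) :=
    (Set.Icc 0 (∑ i, ∑ j, A i j) ×ˢ stdSimplex ℝ (Fin m)) ∩
      {p | ∀ i, p.1 * p.2 i ≤ (A *ᵥ p.2) i} with hK
  have hcl : IsClosed {p : ℝ × (Fin m → ℝ) | ∀ i, p.1 * p.2 i ≤ (A *ᵥ p.2) i} := by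
    rw [Set.ofPred_forall]
    refine isClosed_iInter fun i => isClosed_le (by fun_prop) ?_
    simp only [Matrix.mulVec, dotProduct]
    fun_prop
  have hKc : IsCompact K := (isCompact_Icc.prod (isCompact_stdSimplex ℝ (Fin m))).inter_right hcl
  have hmem : ∀ r : ℝ, 0 ≤ r → ∀ y ∈ stdSimplex ℝ (Fin m), (∀ i, r * y i ≤ (A *ᵥ y) i) →
      (r, y) ∈ K := by
    intro r hr y hy hry
    refine ⟨⟨⟨hr, ?_⟩, hy⟩, hry⟩
    have hy1 : ∀ j, y j ≤ 1 := fun j => by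
      rw [← hy.2]; exact Finset.single_le_sum (fun i _ => hy.1 i) (Finset.mem_univ j)
    calc r = ∑ i, r * y i := by rw [← Finset.mul_sum, hy.2, mul_one]
      _ ≤ ∑ i, (A *ᵥ y) i := Finset.sum_le_sum fun i _ => hry i
      _ = ∑ i, ∑ j, A i j * y j := rfl
      _ ≤ ∑ i, ∑ j, A i j := Finset.sum_le_sum fun i _ => Finset.sum_le_sum fun j _ =>
          mul_le_of_le_one_right (hA i j) (hy1 j)
  have hKne : K.Nonempty := by
    refine ⟨_, hmem 0 le_rfl (Pi.single 0 1) (single_mem_stdSimplex ℝ 0) fun i => ?_⟩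
    rw [zero_mul]
    exact mulVec_nonneg_of_nonneg hA (single_mem_stdSimplex ℝ (0 : Fin m)).1 i
  obtain ⟨⟨r, x⟩, ⟨⟨hr, hx⟩, hrx⟩, hmax⟩ := hKc.exists_isMaxOn hKne continuous_fst.continuousOn
  exact ⟨r, hr.1, x, hx, hrx, fun r' hr' y hy hy' => hmax (hmem r' hr' y hy hy')⟩

/-- Perron–Frobenius: a nonnegative irreducible matrix has a positive eigenvector. -/
theorem Irreducible'.exists_pos_eigenvector {m : ℕ} [NeZero m] {A : Matrix (Fin m) (Fin m) ℝ}
    (h : Irreducible' A) (hA : ∀ i j, 0 ≤ A i j) :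
    ∃ (r : ℝ) (v : Fin m → ℝ), (∀ i, 0 < v i) ∧ A *ᵥ v = r • v := by
  obtain ⟨P, hPA, hP⟩ := h.exists_commute_pos hA
  obtain ⟨r, hr, x, hx, hrx, hmax⟩ := exists_collatzWielandt_max hA
  have hx0 : x ≠ 0 := by
    rintro rfl
    simpa using hx.2
  have hPpos := mulVec_pos_of_pos hP hx.1 hx0
  have hcomm : P *ᵥ (A *ᵥ x - r • x) = A *ᵥ (P *ᵥ x) - r • (P *ᵥ x) := by
    rw [Matrix.mulVec_sub, Matrix.mulVec_smul, Matrix.mulVec_mulVec, Matrix.mulVec_mulVec, hPA.eq]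
  refine ⟨r, P *ᵥ x, hPpos, ?_⟩
  by_contra hne
  have hdiff : A *ᵥ x - r • x ≠ 0 := by
    intro h0
    rw [h0, Matrix.mulVec_zero] at hcomm
    exact hne (sub_eq_zero.mp hcomm.symm)
  have hgain := mulVec_pos_of_pos hP (x := A *ᵥ x - r • x)
    (fun i => by simpa using hrx i) hdiff
  rw [hcomm] at hgain
  set w := P *ᵥ x with hw
  obtain ⟨i₀, hi₀⟩ := Finite.exists_min fun i => (A *ᵥ w - r • w) i / w i
  set ε := (A *ᵥ w - r • w) i₀ / w i₀ with hε
  have hεpos : 0 < ε := div_pos (hgain i₀) (hPpos i₀)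
  have hbetter : ∀ i, (r + ε) * w i ≤ (A *ᵥ w) i := fun i => by
    have h1 := (le_div_iff₀ (hPpos i)).mp (hi₀ i)
    simp only [Pi.sub_apply, Pi.smul_apply, smul_eq_mul] at h1
    linarith [add_mul r ε (w i)]
  have hS : 0 < ∑ i, w i := Finset.sum_pos (fun i _ => hPpos i) Finset.univ_nonempty
  have := hmax (r + ε) (by positivity) ((∑ i, w i)⁻¹ • w)
    ⟨fun i => mul_nonneg (inv_nonneg.mpr hS.le) (hPpos i).le, by
      simp only [Pi.smul_apply, smul_eq_mul]
      rw [← Finset.mul_sum, inv_mul_cancel₀ hS.ne']⟩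
    (fun i => by
      rw [Matrix.mulVec_smul]
      simp only [Pi.smul_apply, smul_eq_mul]
      rw [mul_left_comm]
      exact mul_le_mul_of_nonneg_left (hbetter i) (inv_nonneg.mpr hS.le))
  linarith

/-- A nonnegative vector whose zero set is closed under successors of an irreducible
nonnegative matrix vanishes identically once it vanishes somewhere. -/
theorem Irreducible'.eq_zero_of_apply_eq_zero {m : ℕ} {W : Matrix (Fin m) (Fin m) ℝ}
    (h : Irreducible' W) (hW : ∀ i j, 0 ≤ W i j) {u : Fin m → ℝ} (hu : ∀ i, 0 ≤ u i)
    (hclosed : ∀ i, u i = 0 → (W *ᵥ u) i ≤ 0) {i : Fin m} (hi : u i = 0) : u = 0 := by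
  have hzero : ∀ i, u i = 0 → ∀ j, W i j * u j = 0 := fun i hi j => by
    have h0 : ∑ j, W i j * u j = 0 := (hclosed i hi).antisymm (mulVec_nonneg_of_nonneg hW hu i)
    exact (Finset.sum_eq_zero_iff_of_nonneg fun j _ => mul_nonneg (hW i j) (hu j)).mp h0 j
      (Finset.mem_univ j)
  have hpow : ∀ k : ℕ, ∀ i, u i = 0 → ∀ j, (W ^ k) i j * u j = 0 := by
    intro k
    induction k with
    | zero =>
      intro i hi j
      rw [pow_zero, Matrix.one_apply]
      split_ifs with hij
      · rw [← hij, hi, mul_zero]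
      · rw [zero_mul]
    | succ k ih =>
      intro i hi j
      rw [pow_succ', Matrix.mul_apply, Finset.sum_mul]
      refine Finset.sum_eq_zero fun l _ => ?_
      rcases mul_eq_zero.mp (hzero i hi l) with hl | hl
      · rw [hl, zero_mul, zero_mul]
      · rw [mul_assoc, ih l hl j, mul_zero]
  funext j
  by_cases hij : i = j
  · rw [← hij, hi, Pi.zero_apply]
  · obtain ⟨k, hk⟩ := h i j hij
    exact (mul_eq_zero.mp (hpow k i hi j)).resolve_left hk.ne'

/-- If `D - W` has a positive `μ`-superharmonic vector, and `D + E - W` with `E ≥ 0` diagonal has a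
nonzero nonnegative `μ`-subharmonic vector, then `E = 0`. -/
theorem Irreducible'.perturbation_eq_zero {m : ℕ} {W : Matrix (Fin m) (Fin m) ℝ}
    (h : Irreducible' W) (hW : ∀ i j, 0 ≤ W i j) {d e v y : Fin m → ℝ} {μ : ℝ}
    (hv : ∀ i, 0 < v i) (hvμ : ∀ i, μ * v i ≤ d i * v i - (W *ᵥ v) i)
    (he : ∀ i, 0 ≤ e i) (hy : ∀ i, 0 ≤ y i) (hy0 : y ≠ 0)
    (hyμ : ∀ i, (d i + e i) * y i - (W *ᵥ y) i ≤ μ * y i) : e = 0 := by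
  obtain ⟨j, hj⟩ := Function.ne_iff.mp hy0
  have : Nonempty (Fin m) := ⟨j⟩
  obtain ⟨i₀, hi₀⟩ := Finite.exists_max fun i => y i / v i
  set t := y i₀ / v i₀ with ht
  have htpos : 0 < t := (div_pos ((hy j).lt_of_ne' hj) (hv j)).trans_le (hi₀ j)
  have hWu : ∀ i, (W *ᵥ (t • v - y)) i = t * (W *ᵥ v) i - (W *ᵥ y) i := fun i => by
    rw [Matrix.mulVec_sub, Matrix.mulVec_smul]; rfl
  have hscaled : ∀ i, t * (μ * v i) ≤ t * (d i * v i - (W *ᵥ v) i) := fun i =>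
    mul_le_mul_of_nonneg_left (hvμ i) htpos.le
  have hu : t • v - y = 0 := by
    refine h.eq_zero_of_apply_eq_zero hW (fun i => ?_) (fun i hi => ?_) (i := i₀) ?_
    · have := (div_le_iff₀ (hv i)).mp (hi₀ i)
      simpa using this
    · rw [hWu]
      have hyi : y i = t * v i := by
        simp only [Pi.sub_apply, Pi.smul_apply, smul_eq_mul] at hi
        linarith
      have h1 := hyμ i
      have h2 := mul_nonneg (he i) (hy i)
      have h3 := hscaled i
      rw [add_mul] at h1
      have h4 : d i * y i = t * (d i * v i) := by rw [hyi]; ring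
      have h5 : μ * y i = t * (μ * v i) := by rw [hyi]; ring
      linarith [mul_sub t (d i * v i) ((W *ᵥ v) i)]
    · simp only [Pi.sub_apply, Pi.smul_apply, smul_eq_mul, ht]
      rw [div_mul_cancel₀ _ (hv i₀).ne', sub_self]
  have hyt : y = t • v := (sub_eq_zero.mp hu).symm
  funext i
  have h1 := hyμ i
  have h2 := hscaled i
  have h3 := hWu i
  rw [hu, Matrix.mulVec_zero, Pi.zero_apply] at h3
  have hyi : y i = t * v i := congrFun hyt i
  rw [hyi] at h1
  have h4 : e i * (t * v i) ≤ 0 := by linarith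
  exact (nonpos_of_mul_nonpos_left h4 (mul_pos htpos (hv i))).antisymm (he i)

theorem Matrix.mem_spectrum_iff_exists_mulVec {ι K : Type*} [Fintype ι] [DecidableEq ι] [Field K]
    {M : Matrix ι ι K} {z : K} : z ∈ spectrum K M ↔ ∃ x ≠ 0, M *ᵥ x = z • x := by
  rw [spectrum.mem_iff, Matrix.isUnit_iff_isUnit_det, isUnit_iff_ne_zero, not_not,
    ← Matrix.exists_mulVec_eq_zero_iff]
  simp only [Matrix.sub_mulVec, Algebra.algebraMap_eq_smul_one, Matrix.smul_mulVec,
    Matrix.one_mulVec, sub_eq_zero, eq_comm]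

theorem spectrum_fromBlocks_zero₁₂ {ι κ K : Type*} [Fintype ι] [DecidableEq ι] [Fintype κ]
    [DecidableEq κ] [Field K] (A : Matrix ι ι K) (C : Matrix κ ι K) (D : Matrix κ κ K) :
    spectrum K (Matrix.fromBlocks A 0 C D) = spectrum K A ∪ spectrum K D := by
  ext z
  have hz : algebraMap K (Matrix (ι ⊕ κ) (ι ⊕ κ) K) z - Matrix.fromBlocks A 0 C D =
      Matrix.fromBlocks (algebraMap K _ z - A) 0 (-C) (algebraMap K _ z - D) := by
    simp only [Algebra.algebraMap_eq_smul_one, ← Matrix.fromBlocks_one, Matrix.fromBlocks_smul,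
      sub_eq_add_neg, Matrix.fromBlocks_neg, Matrix.fromBlocks_add]
    simp
  rw [Set.mem_union, spectrum.mem_iff, spectrum.mem_iff, spectrum.mem_iff, hz,
    Matrix.isUnit_fromBlocks_zero₁₂, not_and_or]

/-- The infimum defining the spectral gap is attained if there is a nonzero eigenvalue. -/
theorem exists_re_eq_spectralGap {ι : Type*} [Fintype ι] [DecidableEq ι] {L : Matrix ι ι ℝ}
    (h : ∃ z ∈ spectrum ℂ (L.map Complex.ofReal), z ≠ 0) :
    ∃ z ∈ spectrum ℂ (L.map Complex.ofReal), z ≠ 0 ∧ z.re = spectralGap L := by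
  obtain ⟨z, hz, hz0⟩ := h
  refine Set.Nonempty.csInf_mem (s := {r : ℝ | ∃ z ∈ spectrum ℂ (L.map Complex.ofReal),
    z ≠ 0 ∧ z.re = r}) ⟨z.re, z, hz, hz0, rfl⟩ ?_
  refine ((Matrix.finite_spectrum (L.map Complex.ofReal)).image Complex.re).subset ?_
  rintro _ ⟨w, hw, -, rfl⟩
  exact ⟨w, hw, rfl⟩

theorem lapl_add_diagonal_mulVec {m : ℕ} (W : Matrix (Fin m) (Fin m) ℝ) (c v : Fin m → ℝ)
    (i : Fin m) : ((lapl W + Matrix.diagonal c) *ᵥ v) i =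
      (∑ j, W i j + c i) * v i - (W *ᵥ v) i := by
  simp only [lapl, Matrix.add_mulVec, Matrix.sub_mulVec, Pi.add_apply, Pi.sub_apply,
    Matrix.mulVec_diagonal]
  ring

theorem lapl_add_diagonal_map_mulVec {m : ℕ} (W : Matrix (Fin m) (Fin m) ℝ) (c : Fin m → ℝ)
    (x : Fin m → ℂ) (i : Fin m) : ((lapl W + Matrix.diagonal c).map Complex.ofReal *ᵥ x) i =
      ((∑ j, W i j + c i : ℝ) : ℂ) * x i - ∑ j, (W i j : ℂ) * x j := by
  have hmap : (lapl W + Matrix.diagonal c).map Complex.ofReal =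
      Matrix.diagonal (fun i => ((∑ j, W i j + c i : ℝ) : ℂ)) - W.map Complex.ofReal := by
    ext i j
    by_cases hij : i = j <;> simp [lapl, hij]
    ring
  rw [hmap, Matrix.sub_mulVec, Pi.sub_apply, Matrix.mulVec_diagonal]
  rfl

/-- The moduli of an eigenvector of `L + D_c` form a subharmonic vector. -/
theorem norm_eigenvector_subharmonic {m : ℕ} {W : Matrix (Fin m) (Fin m) ℝ}
    (hW : ∀ i j, 0 ≤ W i j) {c : Fin m → ℝ} {x : Fin m → ℂ} {z : ℂ}
    (hx : (lapl W + Matrix.diagonal c).map Complex.ofReal *ᵥ x = z • x) (i : Fin m) :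
    (∑ j, W i j + c i) * ‖x i‖ - (W *ᵥ fun j => ‖x j‖) i ≤ z.re * ‖x i‖ := by
  have hi := congrFun hx i
  rw [lapl_add_diagonal_map_mulVec, Pi.smul_apply, smul_eq_mul] at hi
  have hsum : (((∑ j, W i j + c i : ℝ) : ℂ) - z) * x i = ∑ j, (W i j : ℂ) * x j := by
    rw [sub_mul, ← hi]; ring
  have hre : (∑ j, W i j + c i) - z.re ≤ ‖((∑ j, W i j + c i : ℝ) : ℂ) - z‖ := by
    have := Complex.re_le_norm (((∑ j, W i j + c i : ℝ) : ℂ) - z)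
    rwa [Complex.sub_re, Complex.ofReal_re] at this
  have hnorm : ((∑ j, W i j + c i) - z.re) * ‖x i‖ ≤ (W *ᵥ fun j => ‖x j‖) i := by
    calc ((∑ j, W i j + c i) - z.re) * ‖x i‖
        ≤ ‖((∑ j, W i j + c i : ℝ) : ℂ) - z‖ * ‖x i‖ :=
          mul_le_mul_of_nonneg_right hre (norm_nonneg _)
      _ = ‖∑ j, (W i j : ℂ) * x j‖ := by rw [← norm_mul, hsum]
      _ ≤ ∑ j, ‖(W i j : ℂ) * x j‖ := norm_sum_le _ _
      _ = ∑ j, W i j * ‖x j‖ := Finset.sum_congr rfl fun j _ => by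
          rw [norm_mul, Complex.norm_real, Real.norm_of_nonneg (hW i j)]
  linarith [sub_mul (∑ j, W i j + c i) z.re ‖x i‖]

/-- A grounded Laplacian `L + D_c` of a strongly connected digraph has a positive eigenvector. -/
theorem exists_pos_eigenvector_lapl_add_diagonal {m : ℕ} [NeZero m]
    {W : Matrix (Fin m) (Fin m) ℝ} (h : Irreducible' W) (hW : ∀ i j, 0 ≤ W i j)
    (c : Fin m → ℝ) : ∃ (r : ℝ) (v : Fin m → ℝ), (∀ i, 0 < v i) ∧
      (lapl W + Matrix.diagonal c) *ᵥ v = r • v := by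
  obtain ⟨i₀, hi₀⟩ := Finite.exists_max fun i => ∑ j, W i j + c i
  set s := ∑ j, W i₀ j + c i₀
  have hWA : ∀ i j, W i j ≤
      (Matrix.diagonal (fun i => s - (∑ j, W i j + c i)) + W) i j := fun i j => by
    rw [Matrix.add_apply, Matrix.diagonal_apply]
    split_ifs
    · linarith [hi₀ i]
    · linarith
  obtain ⟨r, v, hv, hrv⟩ := (h.mono hW hWA).exists_pos_eigenvector
    fun i j => (hW i j).trans (hWA i j)
  refine ⟨s - r, v, hv, funext fun i => ?_⟩
  have hi := congrFun hrv i
  rw [Matrix.add_mulVec, Pi.add_apply, Matrix.mulVec_diagonal, Pi.smul_apply, smul_eq_mul] at hi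
  rw [lapl_add_diagonal_mulVec, Pi.smul_apply, smul_eq_mul]
  linarith

/-- If `μ` bounds the real parts of the eigenvalues of `L + D_c` from below, then a nonzero
nonnegative diagonal perturbation `D_e` pushes all real parts strictly above `μ`. -/
theorem lt_re_of_mem_spectrum_perturbed {m : ℕ} {W : Matrix (Fin m) (Fin m) ℝ}
    (h : Irreducible' W) (hW : ∀ i j, 0 ≤ W i j) {c e : Fin m → ℝ} {μ : ℝ}
    (hμ : ∀ z : ℂ, z ∈ spectrum ℂ ((lapl W + Matrix.diagonal c).map Complex.ofReal) → μ ≤ z.re)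
    (he : ∀ i, 0 ≤ e i) (he0 : e ≠ 0) {z : ℂ}
    (hz : z ∈ spectrum ℂ
      ((lapl W + Matrix.diagonal c + Matrix.diagonal e).map Complex.ofReal)) : μ < z.re := by
  obtain ⟨i₁, -⟩ := Function.ne_iff.mp he0
  have : NeZero m := ⟨(Fin.pos i₁).ne'⟩
  by_contra! hle
  obtain ⟨r, v, hv, hrv⟩ := exists_pos_eigenvector_lapl_add_diagonal h hW c
  have hr : μ ≤ r := by
    refine hμ (r : ℂ) (Matrix.mem_spectrum_iff_exists_mulVec.mpr
      ⟨fun i => (v i : ℂ), fun h0 => ?_, funext fun i => ?_⟩)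
    · exact (hv i₁).ne' (Complex.ofReal_eq_zero.mp (congrFun h0 i₁))
    · have := Complex.ofRealHom.map_mulVec (lapl W + Matrix.diagonal c) v i
      rw [hrv, Pi.smul_apply, smul_eq_mul, map_mul] at this
      exact this.symm
  rw [add_assoc, Matrix.diagonal_add] at hz
  obtain ⟨x, hx0, hx⟩ := Matrix.mem_spectrum_iff_exists_mulVec.mp hz
  refine he0 (h.perturbation_eq_zero hW (d := fun i => ∑ j, W i j + c i) (y := fun i => ‖x i‖)
    (μ := μ) hv (fun i => ?_) he (fun i => norm_nonneg _) (fun h0 => ?_) fun i => ?_)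
  · rw [← lapl_add_diagonal_mulVec, hrv, Pi.smul_apply, smul_eq_mul]
    exact mul_le_mul_of_nonneg_right hr (hv i).le
  · exact hx0 (funext fun i => norm_eq_zero.mp (congrFun h0 i))
  · have := norm_eigenvector_subharmonic hW hx i
    rw [← add_assoc] at this
    exact this.trans (mul_le_mul_of_nonneg_right hle (norm_nonneg _))

/-- if the spectral gap of the block Laplacian
`L_W = [[L₁, 0], [-C, L₂ + D_C]]` equals the minimal eigenvalue `μ` of `L₂ + D_C`
(every nonzero eigenvalue of `L₁` has real part strictly greater than `μ`), then any
nonzero nonnegative perturbation `Δ` in direction of the cutset makes the spectral gap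
strictly greater than `μ`: reinforcing the cutset strictly increases synchronizability. -/
theorem stmt12 {n m : ℕ}
    (W₁ : Matrix (Fin n) (Fin n) ℝ) (W₂ : Matrix (Fin m) (Fin m) ℝ)
    (hW₁nn : ∀ i j, 0 ≤ W₁ i j) (hW₁diag : ∀ i, W₁ i i = 0) (hW₁irr : Irreducible' W₁)
    (hW₂nn : ∀ i j, 0 ≤ W₂ i j) (hW₂diag : ∀ i, W₂ i i = 0) (hW₂irr : Irreducible' W₂)
    (C : Matrix (Fin m) (Fin n) ℝ)
    (hCnn : ∀ i j, 0 ≤ C i j) (hC0 : ∃ i j, 0 < C i j)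
    (μ : ℝ) (hμpos : 0 < μ)
    (hμmem : μ ∈ spectrum ℝ (lapl W₂ + Matrix.diagonal (fun i => ∑ j, C i j)))
    (hμmin : ∀ z : ℂ, z ∈ spectrum ℂ
      ((lapl W₂ + Matrix.diagonal (fun i => ∑ j, C i j)).map Complex.ofReal) → μ ≤ z.re)
    (hL₁ : ∀ z : ℂ, z ∈ spectrum ℂ ((lapl W₁).map Complex.ofReal) → z ≠ 0 → μ < z.re)
    (hgap : spectralGap (Matrix.fromBlocks (lapl W₁) 0 (-C)
      (lapl W₂ + Matrix.diagonal (fun i => ∑ j, C i j))) = μ) :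
    ∀ Δ : Matrix (Fin m) (Fin n) ℝ, (∀ i j, 0 ≤ Δ i j) → Δ ≠ 0 →
      μ < spectralGap (Matrix.fromBlocks (lapl W₁) 0 (-(C + Δ))
        (lapl W₂ + Matrix.diagonal (fun i => ∑ j, C i j)
          + Matrix.diagonal (fun i => ∑ j, Δ i j))) := by
  intro Δ hΔ hΔ0
  have he0 : (fun i => ∑ j, Δ i j) ≠ 0 := fun h0 => hΔ0 <| by
    ext i j
    exact (Finset.sum_eq_zero_iff_of_nonneg fun j _ => hΔ i j).mp (congrFun h0 i) j
      (Finset.mem_univ j)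
  have hpert : ∀ z : ℂ, z ∈ spectrum ℂ ((lapl W₂ + Matrix.diagonal (fun i => ∑ j, C i j)
      + Matrix.diagonal (fun i => ∑ j, Δ i j)).map Complex.ofReal) → μ < z.re := fun z hz =>
    lt_re_of_mem_spectrum_perturbed hW₂irr hW₂nn hμmin
      (fun i => Finset.sum_nonneg fun j _ => hΔ i j) he0 hz
  have hspec : spectrum ℂ ((Matrix.fromBlocks (lapl W₁) 0 (-(C + Δ))
      (lapl W₂ + Matrix.diagonal (fun i => ∑ j, C i j)
        + Matrix.diagonal (fun i => ∑ j, Δ i j))).map Complex.ofReal) =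
      spectrum ℂ ((lapl W₁).map Complex.ofReal) ∪
        spectrum ℂ ((lapl W₂ + Matrix.diagonal (fun i => ∑ j, C i j)
          + Matrix.diagonal (fun i => ∑ j, Δ i j)).map Complex.ofReal) := by
    rw [Matrix.fromBlocks_map, Matrix.map_zero _ Complex.ofReal_zero,
      spectrum_fromBlocks_zero₁₂]
  obtain ⟨i₁, -⟩ := hC0
  have : Nonempty (Fin m) := ⟨i₁⟩
  obtain ⟨w, hw⟩ := spectrum.nonempty_of_isAlgClosed_of_finiteDimensional ℂ
    ((lapl W₂ + Matrix.diagonal (fun i => ∑ j, C i j)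
      + Matrix.diagonal (fun i => ∑ j, Δ i j)).map Complex.ofReal)
  obtain ⟨z, hz, hz0, hzre⟩ := exists_re_eq_spectralGap
    ⟨w, hspec.symm.subset (Or.inr hw), fun h0 => by
      have := hpert w hw
      rw [h0, Complex.zero_re] at this
      linarith⟩
  rw [← hzre]
  rcases hspec.subset hz with hz | hz
  · exact hL₁ z hz hz0
  · exact hpert z hz
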